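/- Let (T_l)_{l∈ℤ} ⊂ B(H) and let A = (T_{j−k}) be the associated Toeplitz matrix. Then A ∈ 𝒞(ℓ²(H)) if and only if there exists g ∈ C(𝕋, B(H)) with ĝ(l) = T_l for all l ∈ ℤ; in that case ‖g‖_{C(𝕋,B(H))} = ‖A‖_{B(ℓ²(H))}. -/

import Mathlib

noncomputable section

/-- The Hilbert space `ℓ²(H)` of square-summable `H`-valued sequences. -/
abbrev ellTwo (H : Type) [NormedAddCommGroup H] [InnerProductSpace ℂ H] : Type :=
  lp (fun _ : ℕ => H) 2

variable {H : Type} [NormedAddCommGroup H] [InnerProductSpace ℂ H] [CompleteSpace H]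
  [TopologicalSpace.SeparableSpace H]

/-- A bounded operator `A` on `ℓ²(H)` is represented by the matrix `T = (T_{kj})`
(with `T k j ∈ B(H)`) if `(A (x e_j))_k = T_{kj} x` for all `j, k, x`. -/
def Represents (T : ℕ → ℕ → (H →L[ℂ] H))
    (A : ellTwo H →L[ℂ] ellTwo H) : Prop :=
  ∀ (j : ℕ) (x : H) (k : ℕ), A (lp.single 2 j x) k = T k j x

/-- A "polynomial" matrix: finitely many nonzero diagonals and uniformly bounded entries. -/
def PolyMat (T : ℕ → ℕ → (H →L[ℂ] H)) : Prop :=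
  (∃ N : ℕ, ∀ k j : ℕ, (N : ℤ) < |(j : ℤ) - (k : ℤ)| → T k j = 0) ∧
  (∃ M : ℝ, ∀ k j : ℕ, ‖T k j‖ ≤ M)

/-- The class `𝒞(ℓ²(H))`: the closure in `B(ℓ²(H))` of the operators represented by
polynomial matrices. -/
def ContinuousClass (A : ellTwo H →L[ℂ] ellTwo H) : Prop :=
  A ∈ closure {B : ellTwo H →L[ℂ] ellTwo H | ∃ T, PolyMat T ∧ Represents T B}

/-- The `l`-th Fourier coefficient of a (`2π`-periodic) `B(H)`-valued function. -/
def opFourierCoeff (f : ℝ → (H →L[ℂ] H)) (l : ℤ) : H →L[ℂ] H :=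
  (1 / (2 * Real.pi) : ℝ) •
    ∫ t in (0 : ℝ)..(2 * Real.pi), Complex.exp (-Complex.I * l * t) • f t

set_option linter.unusedSectionVars false
open Filter Topology

/-- exponential -/
def ee (l : ℤ) (t : ℝ) : ℂ := Complex.exp (Complex.I * l * t)

lemma ee_continuous (l : ℤ) : Continuous (ee l) := by unfold ee; fun_prop

lemma norm_ee (l : ℤ) (t : ℝ) : ‖ee l t‖ = 1 := by
  unfold ee
  have : Complex.I * l * t = ((l * t : ℝ) : ℂ) * Complex.I := by push_cast; ring
  rw [this, Complex.norm_exp_ofReal_mul_I]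

lemma ee_add (l m : ℤ) (t : ℝ) : ee (l + m) t = ee l t * ee m t := by
  unfold ee; rw [← Complex.exp_add]; congr 1; push_cast; ring

lemma ee_zero (t : ℝ) : ee 0 t = 1 := by simp [ee]

lemma conj_ee (l : ℤ) (t : ℝ) : (starRingEnd ℂ) (ee l t) = ee (-l) t := by
  unfold ee; rw [← Complex.exp_conj]; congr 1; simp

lemma ee_periodic (l : ℤ) : Function.Periodic (ee l) (2 * Real.pi) := by
  intro t
  unfold ee
  have : Complex.I * l * ((t + 2 * Real.pi : ℝ) : ℂ) =
    Complex.I * l * t + l * (2 * Real.pi * Complex.I) := by push_cast; ring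
  rw [this, Complex.exp_add, Complex.exp_int_mul_two_pi_mul_I, mul_one]

lemma integral_ee (l : ℤ) :
    ∫ t in (0 : ℝ)..(2 * Real.pi), ee l t = if l = 0 then (2 * Real.pi : ℂ) else 0 := by
  split_ifs with h
  · subst h; simp [ee]
  · unfold ee
    have hc : Complex.I * l ≠ 0 := mul_ne_zero Complex.I_ne_zero (by exact_mod_cast h)
    rw [integral_exp_mul_complex hc]
    have : Complex.I * l * ((2 * Real.pi : ℝ) : ℂ) = l * (2 * Real.pi * Complex.I) := by
      push_cast; ring
    rw [this, Complex.exp_int_mul_two_pi_mul_I]; simp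

lemma fc_eq (f : ℝ → (H →L[ℂ] H)) (l : ℤ) : opFourierCoeff f l =
    (1 / (2 * Real.pi) : ℝ) • ∫ t in (0 : ℝ)..(2 * Real.pi), ee (-l) t • f t := by
  unfold opFourierCoeff ee
  congr 2; ext t; congr 2; push_cast; ring

/-- trig polynomial -/
def tp (s : Finset ℤ) (C : ℤ → (H →L[ℂ] H)) (t : ℝ) : H →L[ℂ] H := ∑ l ∈ s, ee l t • C l

lemma tp_continuous (s : Finset ℤ) (C : ℤ → (H →L[ℂ] H)) : Continuous (tp s C) := by
  unfold tp
  exact continuous_finsetSum _ fun l _ => (ee_continuous l).smul continuous_const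

lemma tp_periodic (s : Finset ℤ) (C : ℤ → (H →L[ℂ] H)) :
    Function.Periodic (tp s C) (2 * Real.pi) := by
  intro t; unfold tp; simp_rw [ee_periodic _ t]

lemma tp_sub (s : Finset ℤ) (C D : ℤ → (H →L[ℂ] H)) (t : ℝ) :
    tp s (C - D) t = tp s C t - tp s D t := by
  simp [tp, smul_sub]

lemma tp_mono {s s' : Finset ℤ} (h : s ⊆ s') (C : ℤ → (H →L[ℂ] H))
    (h0 : ∀ l ∉ s, C l = 0) (t : ℝ) : tp s C t = tp s' C t := by
  unfold tp
  exact Finset.sum_subset h fun l _ hl => by simp [h0 l hl]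

lemma tp_congr {s s' : Finset ℤ} (C : ℤ → (H →L[ℂ] H))
    (h0 : ∀ l ∉ s, C l = 0) (h0' : ∀ l ∉ s', C l = 0) (t : ℝ) : tp s C t = tp s' C t := by
  rw [tp_mono Finset.subset_union_left C h0, tp_mono Finset.subset_union_right C h0']

lemma fc_sub {f g : ℝ → (H →L[ℂ] H)} (hf : Continuous f) (hg : Continuous g) (l : ℤ) :
    opFourierCoeff (f - g) l = opFourierCoeff f l - opFourierCoeff g l := by
  simp only [fc_eq, Pi.sub_apply, smul_sub]
  rw [intervalIntegral.integral_sub, smul_sub]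
  · exact ((ee_continuous _).smul hf).intervalIntegrable _ _
  · exact ((ee_continuous _).smul hg).intervalIntegrable _ _

lemma fc_norm_le {f : ℝ → (H →L[ℂ] H)} {M : ℝ} (hM : ∀ t, ‖f t‖ ≤ M) (l : ℤ) :
    ‖opFourierCoeff f l‖ ≤ M := by
  rw [fc_eq, norm_smul]
  have hpi := Real.pi_pos
  have := intervalIntegral.norm_integral_le_of_norm_le_const (a := 0) (b := 2 * Real.pi) (C := M)
    (f := fun t => ee (-l) t • f t) (fun t _ => by rw [norm_smul, norm_ee, one_mul]; exact hM t)
  rw [Real.norm_of_nonneg (by positivity)]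
  rw [sub_zero, abs_of_pos (by positivity)] at this
  calc _ ≤ 1 / (2 * Real.pi) * (M * (2 * Real.pi)) := by gcongr
    _ = M := by field_simp

lemma fc_tp (s : Finset ℤ) (C : ℤ → (H →L[ℂ] H)) (l : ℤ) :
    opFourierCoeff (tp s C) l = if l ∈ s then C l else 0 := by
  rw [fc_eq]
  have hpi := Real.pi_pos
  have h1 : ∀ t, ee (-l) t • tp s C t = ∑ m ∈ s, ee (m - l) t • C m := by
    intro t
    simp only [tp, Finset.smul_sum, smul_smul]
    refine Finset.sum_congr rfl fun m _ => ?_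
    rw [← ee_add, neg_add_eq_sub]
  simp only [h1]
  rw [intervalIntegral.integral_finsetSum]
  · simp only [intervalIntegral.integral_smul_const, integral_ee, sub_eq_zero, ite_smul, zero_smul,
      Finset.sum_ite_eq']
    split_ifs
    · have : (2 * Real.pi : ℂ) • C l = (2 * Real.pi : ℝ) • C l := by
        rw [← Complex.coe_smul]; push_cast; rfl
      rw [this, smul_smul, one_div, inv_mul_cancel₀ (by positivity), one_smul]
    · simp
  · intro m _
    exact ((ee_continuous _).smul continuous_const).intervalIntegrable _ _

lemma fc_tp' (s : Finset ℤ) (C : ℤ → (H →L[ℂ] H)) (h0 : ∀ l ∉ s, C l = 0) :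
    opFourierCoeff (tp s C) = C := by
  ext1 l
  rw [fc_tp]; split_ifs with h
  · rfl
  · exact (h0 l h).symm

lemma form_identity {g : ℝ → (H →L[ℂ] H)} (hg : Continuous g) (N : ℕ) (x y : ℕ → H) :
    ∑ k ∈ Finset.range N, ∑ j ∈ Finset.range N,
      inner ℂ (y k) (opFourierCoeff g ((j : ℤ) - k) (x j)) =
    (1 / (2 * Real.pi) : ℝ) • ∫ t in (0 : ℝ)..(2 * Real.pi),
      inner ℂ (∑ k ∈ Finset.range N, ee (-k) t • y k)
        (g t (∑ j ∈ Finset.range N, ee (-j) t • x j)) := by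
  have h1 : ∀ t, inner ℂ (∑ k ∈ Finset.range N, ee (-k) t • y k)
        (g t (∑ j ∈ Finset.range N, ee (-j) t • x j)) =
      ∑ k ∈ Finset.range N, ∑ j ∈ Finset.range N,
        ee (-((j : ℤ) - k)) t * inner ℂ (y k) (g t (x j)) := by
    intro t
    rw [sum_inner]
    refine Finset.sum_congr rfl fun k _ => ?_
    rw [map_sum, inner_sum]
    refine Finset.sum_congr rfl fun j _ => ?_
    rw [map_smul, inner_smul_left, inner_smul_right, conj_ee]
    rw [← mul_assoc, ← ee_add]; congr 2; ring
  have hc : ∀ k j : ℕ, Continuous fun t => ee (-((j : ℤ) - k)) t * inner ℂ (y k) (g t (x j)) := by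
    intro k j
    exact (ee_continuous _).mul (continuous_const.inner (hg.clm_apply continuous_const))
  simp only [h1]
  rw [intervalIntegral.integral_finsetSum, Finset.smul_sum]
  swap
  · intro k _
    exact (continuous_finsetSum _ fun j _ => hc k j).intervalIntegrable _ _
  refine Finset.sum_congr rfl fun k _ => ?_
  rw [intervalIntegral.integral_finsetSum, Finset.smul_sum]
  swap
  · intro j _
    exact (hc k j).intervalIntegrable _ _
  refine Finset.sum_congr rfl fun j _ => ?_
  rw [fc_eq]
  let L : (H →L[ℂ] H) →L[ℂ] ℂ := (innerSL ℂ (y k)).comp (ContinuousLinearMap.apply ℂ H (x j))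
  have hL : ∀ B, L B = inner ℂ (y k) (B (x j)) := fun B => rfl
  have := L.intervalIntegral_comp_comm (μ := MeasureTheory.volume) (a := 0) (b := 2 * Real.pi)
    (f := fun t => ee (-((j : ℤ) - k)) t • g t)
    (((ee_continuous _).smul hg).intervalIntegrable _ _)
  rw [← hL]
  rw [← Complex.coe_smul, map_smul, Complex.coe_smul, ← this]
  simp [hL]

lemma form_bound {g : ℝ → (H →L[ℂ] H)} (hg : Continuous g) {M : ℝ} (hM : ∀ t, ‖g t‖ ≤ M)
    (N : ℕ) (x y : ℕ → H) :
    ‖∑ k ∈ Finset.range N, ∑ j ∈ Finset.range N,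
      inner ℂ (y k) (opFourierCoeff g ((j : ℤ) - k) (x j))‖ ≤
    M * ((∑ j ∈ Finset.range N, ‖x j‖ ^ 2 + ∑ k ∈ Finset.range N, ‖y k‖ ^ 2) / 2) := by
  have hpi := Real.pi_pos
  have hM0 : 0 ≤ M := (norm_nonneg _).trans (hM 0)
  let Z : (ℕ → H) → ℝ → H := fun z t => ∑ j ∈ Finset.range N, ee (-j) t • z j
  have hZc : ∀ z, Continuous (Z z) := fun z =>
    continuous_finsetSum _ fun l _ => (ee_continuous _).smul continuous_const
  have hZ : ∀ z, (1 / (2 * Real.pi) : ℝ) * ∫ t in (0 : ℝ)..(2 * Real.pi), ‖Z z t‖ ^ 2 =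
      ∑ j ∈ Finset.range N, ‖z j‖ ^ 2 := by
    intro z
    have h := form_identity (H := H) (g := tp {0} fun _ => 1) (tp_continuous _ _) N z z
    have h2 : ∀ t, tp (H := H) {0} (fun _ => 1) t = 1 := by intro t; simp [tp, ee_zero]
    simp only [fc_tp, h2] at h
    have h3 : ∀ k ∈ Finset.range N, ∑ j ∈ Finset.range N,
        inner ℂ (z k) ((if (j : ℤ) - k ∈ ({0} : Finset ℤ) then (1 : H →L[ℂ] H) else 0) (z j)) =
        ((‖z k‖ ^ 2 : ℝ) : ℂ) := by
      intro k hk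
      rw [Finset.sum_eq_single k]
      · simp [inner_self_eq_norm_sq_to_K]
      · intro j _ hjk
        rw [if_neg]; · simp
        simp; omega
      · intro h; exact absurd hk h
    rw [Finset.sum_congr rfl h3] at h
    have h4 : ∀ t, inner ℂ (Z z t) ((1 : H →L[ℂ] H) (Z z t)) = ((‖Z z t‖ ^ 2 : ℝ) : ℂ) := by
      intro t; simp [inner_self_eq_norm_sq_to_K]
    change _ = (1 / (2 * Real.pi) : ℝ) • ∫ t in (0 : ℝ)..(2 * Real.pi),
      inner ℂ (Z z t) ((1 : H →L[ℂ] H) (Z z t)) at h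
    simp only [h4] at h
    rw [intervalIntegral.integral_ofReal, Complex.real_smul] at h
    exact_mod_cast h.symm
  rw [form_identity hg, norm_smul, Real.norm_of_nonneg (by positivity), ← hZ, ← hZ]
  have hb : ‖∫ t in (0 : ℝ)..(2 * Real.pi), inner ℂ (Z y t) (g t (Z x t))‖ ≤
      ∫ t in (0 : ℝ)..(2 * Real.pi), M / 2 * (‖Z x t‖ ^ 2 + ‖Z y t‖ ^ 2) := by
    apply intervalIntegral.norm_integral_le_of_norm_le (by positivity)
    · refine Eventually.of_forall fun t _ => ?_
      have h1 : ‖inner ℂ (Z y t) (g t (Z x t))‖ ≤ ‖Z y t‖ * (M * ‖Z x t‖) :=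
        (norm_inner_le_norm _ _).trans (by
          gcongr; exact (g t).le_of_opNorm_le (hM t) _)
      nlinarith [mul_nonneg hM0 (sq_nonneg (‖Z x t‖ - ‖Z y t‖))]
    · apply Continuous.intervalIntegrable
      have := hZc x; have := hZc y; fun_prop
  rw [intervalIntegral.integral_const_mul, intervalIntegral.integral_add] at hb
  rotate_left
  · apply Continuous.intervalIntegrable
    have := hZc x; fun_prop
  · apply Continuous.intervalIntegrable
    have := hZc y; fun_prop
  refine (mul_le_mul_of_nonneg_left hb (by positivity)).trans (le_of_eq ?_)
  ring

lemma norm_le_of_form {E : Type*} [NormedAddCommGroup E] [InnerProductSpace ℂ E] (B : E →L[ℂ] E)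
    {M : ℝ} (hM : 0 ≤ M)
    (h : ∀ x y, ‖inner ℂ y (B x)‖ ≤ M * ((‖x‖ ^ 2 + ‖y‖ ^ 2) / 2)) : ‖B‖ ≤ M := by
  refine B.opNorm_le_bound hM fun x => ?_
  by_cases hB : B x = 0
  · rw [hB, norm_zero]; positivity
  have hBx : 0 < ‖B x‖ := norm_pos_iff.2 hB
  have hx : 0 < ‖x‖ := norm_pos_iff.2 (by rintro rfl; simp at hB)
  have := h x (((‖x‖ / ‖B x‖ : ℝ) : ℂ) • B x)
  rw [inner_smul_left, inner_self_eq_norm_sq_to_K, norm_smul] at this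
  simp only [norm_mul, RCLike.norm_conj, Complex.norm_real, norm_pow, norm_div, norm_norm,
    Complex.coe_algebraMap] at this
  have e1 : ‖x‖ / ‖B x‖ * ‖B x‖ = ‖x‖ := by field_simp
  have e2 : ‖x‖ / ‖B x‖ * ‖B x‖ ^ 2 = ‖x‖ * ‖B x‖ := by field_simp
  rw [e1, e2] at this
  have : ‖x‖ * ‖B x‖ ≤ ‖x‖ * (M * ‖x‖) := by linarith [this]
  exact le_of_mul_le_mul_left this hx

lemma rep_form {b : ℕ → ℕ → (H →L[ℂ] H)} {A : ellTwo H →L[ℂ] ellTwo H} (hA : Represents b A)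
    (N : ℕ) (x y : ℕ → H) :
    inner ℂ (∑ k ∈ Finset.range N, (lp.single 2 k (y k) : ellTwo H))
      (A (∑ j ∈ Finset.range N, (lp.single 2 j (x j) : ellTwo H))) =
    ∑ k ∈ Finset.range N, ∑ j ∈ Finset.range N, inner ℂ (y k) (b k j (x j)) := by
  rw [sum_inner]
  refine Finset.sum_congr rfl fun k _ => ?_
  rw [map_sum, inner_sum]
  refine Finset.sum_congr rfl fun j _ => ?_
  rw [lp.inner_single_left, hA]

lemma norm_sq_single (N : ℕ) (x : ℕ → H) :
    ‖∑ j ∈ Finset.range N, (lp.single 2 j (x j) : ellTwo H)‖ ^ 2 =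
      ∑ j ∈ Finset.range N, ‖x j‖ ^ 2 := by
  have := lp.norm_sum_single (p := 2) (E := fun _ : ℕ => H) (by norm_num) x (Finset.range N)
  simpa using this

lemma rep_form_bound {b : ℕ → ℕ → (H →L[ℂ] H)} {A : ellTwo H →L[ℂ] ellTwo H}
    (hA : Represents b A) (N : ℕ) (x y : ℕ → H) :
    ‖∑ k ∈ Finset.range N, ∑ j ∈ Finset.range N, inner ℂ (y k) (b k j (x j))‖ ≤
    ‖A‖ * ((∑ j ∈ Finset.range N, ‖x j‖ ^ 2 + ∑ k ∈ Finset.range N, ‖y k‖ ^ 2) / 2) := by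
  rw [← rep_form hA, ← norm_sq_single, ← norm_sq_single]
  set X := ∑ j ∈ Finset.range N, (lp.single 2 j (x j) : ellTwo H)
  set Y := ∑ j ∈ Finset.range N, (lp.single 2 j (y j) : ellTwo H)
  have h1 : ‖inner ℂ Y (A X)‖ ≤ ‖Y‖ * (‖A‖ * ‖X‖) :=
    (norm_inner_le_norm _ _).trans (by gcongr; exact A.le_opNorm _)
  nlinarith [mul_nonneg (norm_nonneg A) (sq_nonneg (‖X‖ - ‖Y‖))]

lemma rep_norm_le {b : ℕ → ℕ → (H →L[ℂ] H)} {A : ellTwo H →L[ℂ] ellTwo H}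
    (hA : Represents b A) {M : ℝ} (hM : 0 ≤ M)
    (h : ∀ (N : ℕ) (x y : ℕ → H),
    ‖∑ k ∈ Finset.range N, ∑ j ∈ Finset.range N, inner ℂ (y k) (b k j (x j))‖ ≤
    M * ((∑ j ∈ Finset.range N, ‖x j‖ ^ 2 + ∑ k ∈ Finset.range N, ‖y k‖ ^ 2) / 2)) :
    ‖A‖ ≤ M := by
  refine norm_le_of_form A hM fun x y => ?_
  have hx := (lp.hasSum_single (p := 2) (by norm_num) x).tendsto_sum_nat
  have hy := (lp.hasSum_single (p := 2) (by norm_num) y).tendsto_sum_nat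
  have h1 := (hy.inner (𝕜 := ℂ) ((A.continuous.tendsto _).comp hx)).norm
  have h2 := (((hx.norm.pow 2).add (hy.norm.pow 2)).div_const 2).const_mul M
  refine le_of_tendsto_of_tendsto' h1 h2 fun N => ?_
  simp only [Function.comp]
  rw [rep_form hA, norm_sq_single, norm_sq_single]
  exact h N _ _

/-- index pairs on the `l`-th diagonal -/
def fib (n : ℕ) (l : ℤ) : Finset (ℕ × ℕ) :=
  (Finset.range n ×ˢ Finset.range n).filter fun p => (p.1 : ℤ) - p.2 = l

/-- averaged diagonals -/
def avg (n : ℕ) (b : ℕ → ℕ → (H →L[ℂ] H)) (l : ℤ) : H →L[ℂ] H :=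
  (1 / n : ℂ) • ∑ p ∈ fib n l, b p.2 p.1

/-- Fejer weight -/
def wt (n : ℕ) (l : ℤ) : ℂ := ((fib n l).card : ℂ) / n

/-- symmetric interval -/
abbrev SI (n : ℕ) : Finset ℤ := Finset.Icc (-(n : ℤ)) n

/-- Toeplitz matrix -/
abbrev toep (T : ℤ → (H →L[ℂ] H)) : ℕ → ℕ → (H →L[ℂ] H) := fun k j => T ((j : ℤ) - (k : ℤ))

lemma fib_eq (n : ℕ) (l : ℤ) : (fib n l).card = (n - l.natAbs) := by
  rcases le_total 0 l with h | h
  · lift l to ℕ using h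
    rw [Int.natAbs_natCast]
    have : fib n l = (Finset.range (n - l)).image fun k => (k + l, k) := by
      ext ⟨j, k⟩
      simp only [fib, Finset.mem_filter, Finset.mem_product, Finset.mem_range, Finset.mem_image,
        Prod.mk.injEq]
      constructor
      · intro h; exact ⟨k, by omega, by omega, rfl⟩
      · rintro ⟨a, h1, h2, rfl⟩; omega
    rw [this, Finset.card_image_of_injective, Finset.card_range]
    intro a b hab; simpa using (congrArg Prod.snd hab)
  · obtain ⟨m, rfl⟩ : ∃ m : ℕ, l = -m := ⟨l.natAbs, by omega⟩
    have : fib n (-m) = (Finset.range (n - m)).image fun k => (k, k + m) := by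
      ext ⟨j, k⟩
      simp only [fib, Finset.mem_filter, Finset.mem_product, Finset.mem_range, Finset.mem_image,
        Prod.mk.injEq]
      constructor
      · intro h; exact ⟨j, by omega, rfl, by omega⟩
      · rintro ⟨a, h1, rfl, h2⟩; omega
    rw [this, Finset.card_image_of_injective, Finset.card_range]
    · simp
    intro a b hab; simpa using (congrArg Prod.fst hab)

lemma wt_sub_one (n : ℕ) (hn : 0 < n) (l : ℤ) : ‖wt n l - 1‖ ≤ l.natAbs / n := by
  have hn' : (0 : ℝ) < n := by exact_mod_cast hn
  have : wt n l - 1 = (((((n - l.natAbs : ℕ) : ℝ) - n) / n : ℝ) : ℂ) := by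
    have : (n : ℂ) ≠ 0 := by exact_mod_cast hn.ne'
    unfold wt; rw [fib_eq]; push_cast; field_simp
  rw [this, Complex.norm_real, norm_div, Real.norm_of_nonneg hn'.le]
  gcongr
  rw [Real.norm_eq_abs, abs_le]
  rcases le_total l.natAbs n with h | h
  · rw [Nat.cast_sub h]; constructor <;> simp
  · rw [Nat.sub_eq_zero_of_le h]
    have : (n : ℝ) ≤ l.natAbs := by exact_mod_cast h
    rw [Nat.cast_zero]; constructor <;> linarith

lemma wt_tendsto (l : ℤ) : Tendsto (fun n => wt n l) atTop (𝓝 1) := by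
  rw [tendsto_iff_norm_sub_tendsto_zero]
  refine squeeze_zero' (g := fun n : ℕ => (l.natAbs : ℝ) / n) (Eventually.of_forall fun _ => norm_nonneg _) ?_
    (tendsto_const_div_atTop_nhds_zero_nat _)
  filter_upwards [eventually_gt_atTop 0] with n hn using wt_sub_one n hn l

lemma avg_toep (n : ℕ) (T : ℤ → (H →L[ℂ] H)) (l : ℤ) : avg n (toep T) l = wt n l • T l := by
  unfold avg
  have : ∀ p ∈ fib n l, toep T p.2 p.1 = T l := by
    intro p hp
    have := (Finset.mem_filter.1 hp).2
    simp only [toep, this]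
  rw [Finset.sum_congr rfl this, Finset.sum_const, wt, ← Nat.cast_smul_eq_nsmul ℂ, smul_smul]
  congr 1; ring

lemma avg_zero (n : ℕ) (b : ℕ → ℕ → (H →L[ℂ] H)) (l : ℤ) (hl : l ∉ SI n) : avg n b l = 0 := by
  have : fib n l = ∅ := by
    rw [← Finset.card_eq_zero, fib_eq]
    simp only [SI, Finset.mem_Icc] at hl
    omega
  simp [avg, this]

lemma avg_norm (n : ℕ) {b : ℕ → ℕ → (H →L[ℂ] H)} {M : ℝ} (hM : ∀ k j, ‖b k j‖ ≤ M) (l : ℤ) :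
    ‖avg n b l‖ ≤ M := by
  have hM0 : 0 ≤ M := (norm_nonneg _).trans (hM 0 0)
  rcases Nat.eq_zero_or_pos n with rfl | hn
  · simpa [avg] using hM0
  have hn' : (0 : ℝ) < n := by exact_mod_cast hn
  unfold avg
  rw [norm_smul]
  have h1 : ‖∑ p ∈ fib n l, b p.2 p.1‖ ≤ n * M := by
    refine (norm_sum_le_of_le _ fun p _ => hM p.2 p.1).trans ?_
    rw [Finset.sum_const, nsmul_eq_mul, fib_eq]
    gcongr; omega
  simp only [norm_div, norm_one, Complex.norm_natCast]
  calc _ ≤ 1 / (n : ℝ) * (n * M) := by gcongr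
    _ = M := by field_simp

lemma avg_band (n : ℕ) {b : ℕ → ℕ → (H →L[ℂ] H)} {N : ℕ}
    (hb : ∀ k j : ℕ, (N : ℤ) < |(j : ℤ) - (k : ℤ)| → b k j = 0) (l : ℤ) (hl : l ∉ SI N) :
    avg n b l = 0 := by
  unfold avg
  rw [Finset.sum_eq_zero, smul_zero]
  intro p hp
  have := (Finset.mem_filter.1 hp).2
  apply hb
  rw [this, lt_abs]
  simp only [SI, Finset.mem_Icc] at hl
  omega

lemma tp_avg (n : ℕ) (b : ℕ → ℕ → (H →L[ℂ] H)) (t : ℝ) :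
    tp (SI n) (avg n b) t = (1 / n : ℂ) • ∑ k ∈ Finset.range n, ∑ j ∈ Finset.range n,
      ee ((j : ℤ) - k) t • b k j := by
  rw [Finset.sum_comm, ← Finset.sum_product',
    ← Finset.sum_fiberwise_of_maps_to (t := SI n) (g := fun p => (p.1 : ℤ) - p.2)]
  · unfold tp avg
    rw [Finset.smul_sum]
    refine Finset.sum_congr rfl fun l _ => ?_
    rw [smul_comm, Finset.smul_sum]
    congr 1
    refine Finset.sum_congr rfl fun p hp => ?_
    rw [(Finset.mem_filter.1 hp).2]
  · intro p hp
    simp only [Finset.mem_product, Finset.mem_range, SI, Finset.mem_Icc] at hp ⊢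
    omega

lemma tp_avg_norm {n : ℕ} (hn : 0 < n) {b : ℕ → ℕ → (H →L[ℂ] H)} {M : ℝ} (hM : 0 ≤ M)
    (h : ∀ (x y : ℕ → H),
    ‖∑ k ∈ Finset.range n, ∑ j ∈ Finset.range n, inner ℂ (y k) (b k j (x j))‖ ≤
    M * ((∑ j ∈ Finset.range n, ‖x j‖ ^ 2 + ∑ k ∈ Finset.range n, ‖y k‖ ^ 2) / 2)) (t : ℝ) :
    ‖tp (SI n) (avg n b) t‖ ≤ M := by
  have hn' : (0 : ℝ) < n := by exact_mod_cast hn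
  refine norm_le_of_form _ hM fun x y => ?_
  have key : inner ℂ y (tp (SI n) (avg n b) t x) = (1 / n : ℂ) *
      ∑ k ∈ Finset.range n, ∑ j ∈ Finset.range n,
        inner ℂ (ee k t • y) (b k j (ee j t • x)) := by
    rw [tp_avg, smul_apply, inner_smul_right]
    congr 1
    simp only [sum_apply]
    rw [inner_sum]
    refine Finset.sum_congr rfl fun k _ => ?_
    rw [inner_sum]
    refine Finset.sum_congr rfl fun j _ => ?_
    rw [smul_apply, map_smul, inner_smul_left, inner_smul_right,
      inner_smul_right, conj_ee, ← mul_assoc, ← ee_add]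
    congr 2; ring
  rw [key, norm_mul]
  have := h (fun j => ee j t • x) (fun j => ee j t • y)
  simp only [norm_smul, norm_ee, one_mul, Finset.sum_const, Finset.card_range, nsmul_eq_mul] at this
  simp only [norm_div, norm_one, Complex.norm_natCast]
  calc _ ≤ 1 / (n : ℝ) * (M * ((n * ‖x‖ ^ 2 + n * ‖y‖ ^ 2) / 2)) := by gcongr
    _ = _ := by field_simp

/-- Fejer mean of a coefficient family -/
def fej (n : ℕ) (C : ℤ → (H →L[ℂ] H)) : ℝ → (H →L[ℂ] H) := tp (SI n) (fun l => wt n l • C l)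

lemma fej_eq (n : ℕ) (C : ℤ → (H →L[ℂ] H)) : fej n C = tp (SI n) (avg n (toep C)) := by
  unfold fej; congr 1; ext1 l; rw [avg_toep]

lemma fej_sub (n : ℕ) (C D : ℤ → (H →L[ℂ] H)) (t : ℝ) :
    fej n (C - D) t = fej n C t - fej n D t := by
  simp [fej, tp, smul_sub]

lemma fej_norm_le {n : ℕ} (hn : 0 < n) {g : ℝ → (H →L[ℂ] H)} (hg : Continuous g) {M : ℝ}
    (hM : ∀ t, ‖g t‖ ≤ M) (t : ℝ) : ‖fej n (opFourierCoeff g) t‖ ≤ M := by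
  rw [fej_eq]
  exact tp_avg_norm hn ((norm_nonneg _).trans (hM 0)) (fun x y => form_bound hg hM n x y) t

lemma fej_rep_le {n : ℕ} (hn : 0 < n) {T : ℤ → (H →L[ℂ] H)} {A : ellTwo H →L[ℂ] ellTwo H}
    (hA : Represents (toep T) A) (t : ℝ) : ‖fej n T t‖ ≤ ‖A‖ := by
  rw [fej_eq]
  exact tp_avg_norm hn (norm_nonneg _) (fun x y => rep_form_bound hA n x y) t

lemma fc_fej (n : ℕ) (C : ℤ → (H →L[ℂ] H)) : opFourierCoeff (fej n C) = fun l => wt n l • C l := by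
  rw [fej_eq, fc_tp' _ _ (avg_zero n _)]
  ext1 l; rw [avg_toep]

/-- Fejer mean of trig poly: rate -/
lemma fej_tp_sub {n : ℕ} (hn : 0 < n) {N : ℕ} {C : ℤ → (H →L[ℂ] H)} {M : ℝ} (hM : ∀ l, ‖C l‖ ≤ M)
    (hC : ∀ l ∉ SI N, C l = 0) (t : ℝ) :
    ‖fej n C t - tp (SI N) C t‖ ≤ (2 * N + 1) * N * M / n := by
  have hn' : (0 : ℝ) < n := by exact_mod_cast hn
  have h1 : fej n C t = tp (SI N) (fun l => wt n l • C l) t := by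
    unfold fej
    apply tp_congr
    · intro l hl; rw [← avg_toep, avg_zero _ _ _ hl]
    · intro l hl; rw [hC l hl, smul_zero]
  rw [h1, ← tp_sub]
  unfold tp
  have : ∀ l ∈ SI N, ‖ee l t • ((fun l => wt n l • C l) - C) l‖ ≤ N / n * M := by
    intro l hl
    rw [norm_smul, norm_ee, one_mul]
    have : ((fun l => wt n l • C l) - C) l = (wt n l - 1) • C l := by
      simp [sub_smul]
    rw [this, norm_smul]
    gcongr
    · refine (wt_sub_one n hn l).trans ?_
      gcongr
      simp only [SI, Finset.mem_Icc] at hl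
      omega
    · exact hM l
  refine (norm_sum_le_of_le _ this).trans (le_of_eq ?_)
  rw [Finset.sum_const, nsmul_eq_mul]
  simp only [SI, Int.card_Icc]
  have : ((N : ℤ) + 1 - -(N : ℤ)).toNat = 2 * N + 1 := by omega
  rw [this]; push_cast; ring

/-- being a trigonometric polynomial -/
def IsTP (h : ℝ → (H →L[ℂ] H)) : Prop :=
  ∃ (N : ℕ) (C : ℤ → (H →L[ℂ] H)), (∀ l ∉ SI N, C l = 0) ∧ ∀ t, h t = tp (SI N) C t

lemma SI_mono {m n : ℕ} (h : m ≤ n) : SI m ⊆ SI n := by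
  intro l; simp only [SI, Finset.mem_Icc]; omega

lemma IsTP.add {h k : ℝ → (H →L[ℂ] H)} (hh : IsTP h) (hk : IsTP k) :
    IsTP fun t => h t + k t := by
  obtain ⟨N, C, hC, e⟩ := hh
  obtain ⟨N', D, hD, e'⟩ := hk
  have s1 := SI_mono (le_max_left N N')
  have s2 := SI_mono (le_max_right N N')
  refine ⟨max N N', C + D, ?_, ?_⟩
  · intro l hl
    rw [Pi.add_apply, hC l (fun h => hl (s1 h)), hD l (fun h => hl (s2 h)), add_zero]
  · intro t
    change h t + k t = _
    rw [e, e', tp_mono s1 C hC, tp_mono s2 D hD]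
    simp [tp, Finset.sum_add_distrib]

lemma IsTP.zero : IsTP (fun _ => (0 : H →L[ℂ] H)) :=
  ⟨0, 0, fun _ _ => rfl, fun t => by simp [tp]⟩

lemma IsTP.sum {ι : Type*} (s : Finset ι) {h : ι → ℝ → (H →L[ℂ] H)} (hh : ∀ i, IsTP (h i)) :
    IsTP fun t => ∑ i ∈ s, h i t := by
  classical
  induction s using Finset.induction_on with
  | empty => simpa using IsTP.zero
  | insert a s ha ih => simp only [Finset.sum_insert ha]; exact (hh a).add ih

lemma IsTP.single (l : ℤ) (R : H →L[ℂ] H) : IsTP fun t => ee l t • R := by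
  have hl : l ∈ SI l.natAbs := by simp only [SI, Finset.mem_Icc]; omega
  refine ⟨l.natAbs, Pi.single l R, ?_, ?_⟩
  · intro m hm
    exact Pi.single_eq_of_ne (by rintro rfl; exact hm hl) _
  · intro t
    unfold tp
    rw [Finset.sum_eq_single l]
    · simp
    · intro m _ hm; simp [Pi.single_eq_of_ne hm]
    · intro h; exact absurd hl h

lemma tp_dense_aux [Fact (0 < 2 * Real.pi)] (φ : C(AddCircle (2 * Real.pi), ℂ)) (R : H →L[ℂ] H)
    {ε : ℝ} (hε : 0 < ε) :
    ∃ h : ℝ → (H →L[ℂ] H), IsTP h ∧ ∀ t : ℝ, ‖φ (t : AddCircle (2 * Real.pi)) • R - h t‖ ≤ ε := by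
  have hφ : φ ∈ (Submodule.span ℂ (Set.range (@fourier (2 * Real.pi)))).topologicalClosure := by
    rw [span_fourier_closure_eq_top]; trivial
  rw [← SetLike.mem_coe, Submodule.topologicalClosure_coe, Metric.mem_closure_iff] at hφ
  obtain ⟨ψ, hψ, hd⟩ := hφ (ε / (‖R‖ + 1)) (by positivity)
  refine ⟨fun t => ψ (t : AddCircle (2 * Real.pi)) • R, ?_, ?_⟩
  · have : ∀ R : H →L[ℂ] H, IsTP fun t : ℝ => ψ (t : AddCircle (2 * Real.pi)) • R := by
      refine Submodule.span_induction (p := fun ψ _ => ∀ R : H →L[ℂ] H,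
        IsTP fun t : ℝ => ψ (t : AddCircle (2 * Real.pi)) • R) ?_ ?_ ?_ ?_ hψ
      · rintro _ ⟨l, rfl⟩ R
        have := IsTP.single l R
        convert this using 2 with t
        rw [fourier_coe_apply, ee]
        congr 2
        have : (Real.pi : ℂ) ≠ 0 := by exact_mod_cast Real.pi_ne_zero
        push_cast; field_simp
      · intro R; simpa using IsTP.zero
      · intro a b _ _ ha hb R
        simpa [add_smul] using (ha R).add (hb R)
      · intro c a _ ha R
        have := ha (c • R)
        convert this using 2 with t
        simp [smul_smul, mul_comm]
    exact this R
  · intro t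
    rw [← sub_smul, norm_smul]
    have h1 : ‖φ (t : AddCircle (2 * Real.pi)) - ψ (t : AddCircle (2 * Real.pi))‖ ≤
        ε / (‖R‖ + 1) := by
      rw [← dist_eq_norm]
      exact (ContinuousMap.dist_apply_le_dist _).trans hd.le
    calc _ ≤ ε / (‖R‖ + 1) * (‖R‖ + 1) := by gcongr; linarith
      _ = ε := by field_simp

lemma tp_dense {g : ℝ → (H →L[ℂ] H)} (hg : Continuous g)
    (hp : Function.Periodic g (2 * Real.pi)) {ε : ℝ} (hε : 0 < ε) :
    ∃ h : ℝ → (H →L[ℂ] H), IsTP h ∧ ∀ t : ℝ, ‖g t - h t‖ ≤ ε := by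
  have : Fact (0 < 2 * Real.pi) := ⟨by positivity⟩
  let G : AddCircle (2 * Real.pi) → (H →L[ℂ] H) := hp.lift
  have hG : ∀ t : ℝ, G t = g t := fun t => hp.lift_coe t
  have hGc : Continuous G := by
    refine continuous_quot_lift _ hg
  let U : AddCircle (2 * Real.pi) → Set (AddCircle (2 * Real.pi)) :=
    fun x => {y | ‖G y - G x‖ < ε / 2}
  have hU : ∀ x, IsOpen (U x) := fun x =>
    isOpen_lt (by fun_prop) continuous_const
  obtain ⟨s, hs⟩ := isCompact_univ.elim_finite_subcover U hU
    (fun x _ => Set.mem_iUnion.2 ⟨x, by simp [U, hε]⟩)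
  obtain ⟨ρ, hρ⟩ := PartitionOfUnity.exists_isSubordinate (s := Set.univ)
    (X := AddCircle (2 * Real.pi)) isClosed_univ (fun i : s => U i) (fun i => hU i) (by
      intro x hx
      obtain ⟨i, hi, h⟩ := Set.mem_iUnion₂.1 (hs hx)
      exact Set.mem_iUnion.2 ⟨⟨i, hi⟩, h⟩)
  have hcard : (0 : ℝ) < s.card + 1 := by positivity
  have key : ∀ i : s, ∃ h : ℝ → (H →L[ℂ] H), IsTP h ∧
      ∀ t : ℝ, ‖((ρ i (t : AddCircle (2 * Real.pi)) : ℝ) : ℂ) • G i - h t‖ ≤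
        ε / 2 / (s.card + 1) := by
    intro i
    exact tp_dense_aux ⟨fun x => ((ρ i x : ℝ) : ℂ), by fun_prop⟩ (G i) (by positivity)
  choose h hh1 hh2 using key
  refine ⟨fun t => ∑ i, h i t, IsTP.sum _ hh1, fun t => ?_⟩
  have hsum : ∑ i, ρ i (t : AddCircle (2 * Real.pi)) = 1 := by
    rw [← finsum_eq_sum_of_fintype]; exact ρ.sum_eq_one (Set.mem_univ _)
  have e1 : ‖g t - ∑ i, ((ρ i (t : AddCircle (2 * Real.pi)) : ℝ) : ℂ) • G i‖ ≤ ε / 2 := by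
    have : g t - ∑ i, ((ρ i (t : AddCircle (2 * Real.pi)) : ℝ) : ℂ) • G i =
        ∑ i, ((ρ i (t : AddCircle (2 * Real.pi)) : ℝ) : ℂ) • (G t - G i) := by
      simp only [smul_sub, Finset.sum_sub_distrib]
      rw [← Finset.sum_smul, ← Complex.ofReal_sum, hsum, Complex.ofReal_one, one_smul, hG]
    rw [this]
    have hb : ∀ i ∈ Finset.univ, ‖((ρ i (t : AddCircle (2 * Real.pi)) : ℝ) : ℂ) • (G t - G i)‖ ≤
        ρ i (t : AddCircle (2 * Real.pi)) * (ε / 2) := by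
      intro i _
      rw [norm_smul, Complex.norm_real, Real.norm_of_nonneg (ρ.nonneg _ _)]
      by_cases h0 : ρ i (t : AddCircle (2 * Real.pi)) = 0
      · simp [h0]
      · have : (t : AddCircle (2 * Real.pi)) ∈ U i := hρ i (subset_tsupport _ h0)
        gcongr
        · exact ρ.nonneg _ _
        · exact le_of_lt this
    refine (norm_sum_le_of_le _ hb).trans ?_
    rw [← Finset.sum_mul, hsum, one_mul]
  have e2 : ‖∑ i, ((ρ i (t : AddCircle (2 * Real.pi)) : ℝ) : ℂ) • G i - ∑ i, h i t‖ ≤ ε / 2 := by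
    rw [← Finset.sum_sub_distrib]
    refine (norm_sum_le_of_le _ fun i _ => hh2 i t).trans ?_
    rw [Finset.sum_const, nsmul_eq_mul, Finset.card_univ, Fintype.card_coe]
    calc (s.card : ℝ) * (ε / 2 / (s.card + 1)) ≤ (s.card + 1) * (ε / 2 / (s.card + 1)) := by
          gcongr; linarith
      _ = ε / 2 := by field_simp
  calc _ ≤ _ := norm_sub_le_norm_sub_add_norm_sub _
        (∑ i, ((ρ i (t : AddCircle (2 * Real.pi)) : ℝ) : ℂ) • G i) _
    _ ≤ ε := by linarith

lemma exists_diag (l : ℤ) (R : H →L[ℂ] H) : ∃ B : ellTwo H →L[ℂ] ellTwo H,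
    Represents (fun k j => if (j : ℤ) - k = l then R else 0) B := by
  let F : (ℕ → H) → ℕ → H := fun x k => if 0 ≤ (k : ℤ) + l then R (x ((k : ℤ) + l).toNat) else 0
  have hF : ∀ (x : ellTwo H) (s : Finset ℕ), ∑ k ∈ s, ‖F x k‖ ^ (2 : ENNReal).toReal ≤
      (‖R‖ * ‖x‖) ^ (2 : ENNReal).toReal := by
    intro x s
    have h2 := lp.sum_rpow_le_norm_rpow (p := 2) (E := fun _ : ℕ => H) (by norm_num) x
      ((s.filter fun k : ℕ => 0 ≤ (k : ℤ) + l).image fun k : ℕ => ((k : ℤ) + l).toNat)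
    simp only [ENNReal.toReal_ofNat, Real.rpow_ofNat] at h2 ⊢
    rw [Finset.sum_image] at h2
    swap
    · intro a ha b hb hab
      simp only [Finset.coe_filter, Set.mem_ofPred_eq] at ha hb
      simp only at hab
      omega
    have h3 : ∑ k ∈ s, ‖F x k‖ ^ 2 =
        ∑ k ∈ s.filter (fun k : ℕ => 0 ≤ (k : ℤ) + l), ‖F x k‖ ^ 2 := by
      rw [Finset.sum_filter]
      refine Finset.sum_congr rfl fun k _ => ?_
      split_ifs with h
      · rfl
      · simp [F, h]
    rw [h3, mul_pow]
    refine le_trans ?_ (mul_le_mul_of_nonneg_left h2 (sq_nonneg _))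
    rw [Finset.mul_sum]
    refine Finset.sum_le_sum fun k hk => ?_
    have := (Finset.mem_filter.1 hk).2
    simp only [F, this, if_true]
    rw [← mul_pow]
    gcongr
    exact R.le_opNorm _
  let B₀ : ellTwo H →ₗ[ℂ] ellTwo H :=
    { toFun := fun x => ⟨F x, memℓp_gen' (hF x)⟩
      map_add' := by
        intro x y
        ext k
        simp only [F, lp.coeFn_add, Pi.add_apply]
        split_ifs <;> simp
      map_smul' := by
        intro c x
        ext k
        simp only [F, lp.coeFn_smul, Pi.smul_apply, RingHom.id_apply]
        split_ifs <;> simp }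
  refine ⟨B₀.mkContinuous ‖R‖ fun x => ?_, ?_⟩
  · exact lp.norm_le_of_forall_sum_le (by norm_num) (by positivity) (hF x)
  · intro j x k
    change F (lp.single 2 j x : ellTwo H) k = _
    simp only [F]
    by_cases h : (j : ℤ) - k = l
    · have h0 : 0 ≤ (k : ℤ) + l := by omega
      have h1 : ((k : ℤ) + l).toNat = j := by omega
      rw [if_pos h0, if_pos h, h1, lp.single_apply_self]
    · rw [if_neg h]
      split_ifs with h0
      · rw [lp.single_apply_ne]
        · simp
        · omega
      · simp

lemma exists_rep {N : ℕ} {C : ℤ → (H →L[ℂ] H)} (hC : ∀ l ∉ SI N, C l = 0) :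
    ∃ B : ellTwo H →L[ℂ] ellTwo H, Represents (toep C) B := by
  choose B hB using fun l => exists_diag (H := H) l (C l)
  refine ⟨∑ l ∈ SI N, B l, ?_⟩
  intro j x k
  rw [sum_apply, lp.coeFn_sum, Finset.sum_apply]
  simp only [hB _ j x k]
  by_cases h : (j : ℤ) - k ∈ SI N
  · rw [Finset.sum_eq_single_of_mem _ h]
    · simp
    · intro l _ hl; rw [if_neg (Ne.symm hl)]; rfl
  · rw [Finset.sum_eq_zero]
    · simp [toep, hC _ h]
    · intro l hl; rw [if_neg (by rintro rfl; exact h hl)]; rfl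

lemma exists_bound {N : ℕ} {C : ℤ → (H →L[ℂ] H)} (hC : ∀ l ∉ SI N, C l = 0) :
    ∃ M : ℝ, ∀ l, ‖C l‖ ≤ M := by
  refine ⟨∑ l ∈ SI N, ‖C l‖, fun l => ?_⟩
  by_cases h : l ∈ SI N
  · exact Finset.single_le_sum (f := fun l => ‖C l‖) (fun _ _ => norm_nonneg _) h
  · rw [hC l h, norm_zero]; positivity

lemma polyMat_toep {N : ℕ} {C : ℤ → (H →L[ℂ] H)} (hC : ∀ l ∉ SI N, C l = 0) :
    PolyMat (toep C) := by
  refine ⟨⟨N, fun k j h => hC _ fun hm => ?_⟩, ?_⟩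
  · simp only [SI, Finset.mem_Icc] at hm
    rw [lt_abs] at h; omega
  · obtain ⟨M, hM⟩ := exists_bound hC
    exact ⟨M, fun k j => hM _⟩

lemma Represents.sub {a b : ℕ → ℕ → (H →L[ℂ] H)} {A B : ellTwo H →L[ℂ] ellTwo H}
    (hA : Represents a A) (hB : Represents b B) : Represents (a - b) (A - B) := by
  intro j x k
  have h1 := hA j x k
  have h2 := hB j x k
  simp [h1, h2]

lemma op_norm_le {T : ℤ → (H →L[ℂ] H)} {A : ellTwo H →L[ℂ] ellTwo H} (hA : Represents (toep T) A)
    {g : ℝ → (H →L[ℂ] H)} (hg : Continuous g) (hT : opFourierCoeff g = T) {M : ℝ}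
    (hM : ∀ t, ‖g t‖ ≤ M) : ‖A‖ ≤ M := by
  subst hT
  exact rep_norm_le hA ((norm_nonneg _).trans (hM 0)) fun N x y => form_bound hg hM N x y

lemma fejer_tendsto {g : ℝ → (H →L[ℂ] H)} (hg : Continuous g)
    (hp : Function.Periodic g (2 * Real.pi)) (t : ℝ) :
    Tendsto (fun n => fej n (opFourierCoeff g) t) atTop (𝓝 (g t)) := by
  rw [Metric.tendsto_nhds]
  intro ε hε
  obtain ⟨h, ⟨N, C, hC, hh⟩, hd⟩ := tp_dense hg hp (ε := ε / 4) (by positivity)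
  obtain ⟨M, hM⟩ := exists_bound hC
  obtain rfl : h = tp (SI N) C := funext hh
  have hlim := tendsto_const_div_atTop_nhds_zero_nat ((2 * N + 1) * N * M)
  filter_upwards [eventually_gt_atTop 0, hlim.eventually (gt_mem_nhds (by positivity : 0 < ε / 4))]
    with n hn hn2
  have e1 : ‖fej n (opFourierCoeff g) t - fej n C t‖ ≤ ε / 4 := by
    have h1 := fej_norm_le hn (hg.sub (tp_continuous (SI N) C)) hd t
    have h2 : opFourierCoeff (g - tp (SI N) C) = opFourierCoeff g - C := by
      ext1 l
      rw [fc_sub hg (tp_continuous _ _), fc_tp' (SI N) C hC, Pi.sub_apply]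
    rwa [h2, fej_sub] at h1
  have e2 := fej_tp_sub hn hM hC t
  have e3 := hd t
  rw [dist_eq_norm]
  have : fej n (opFourierCoeff g) t - g t = (fej n (opFourierCoeff g) t - fej n C t) +
    (fej n C t - tp (SI N) C t) - (g t - tp (SI N) C t) := by abel
  rw [this]
  have := norm_sub_le ((fej n (opFourierCoeff g) t - fej n C t) +
    (fej n C t - tp (SI N) C t)) (g t - tp (SI N) C t)
  have := norm_add_le (fej n (opFourierCoeff g) t - fej n C t) (fej n C t - tp (SI N) C t)
  linarith

lemma exists_op {T : ℤ → (H →L[ℂ] H)} {g : ℝ → (H →L[ℂ] H)} (hg : Continuous g)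
    (hp : Function.Periodic g (2 * Real.pi)) (hT : ∀ l, opFourierCoeff g l = T l) :
    ∃ A : ellTwo H →L[ℂ] ellTwo H, Represents (toep T) A ∧ ContinuousClass A := by
  have hpos : ∀ n : ℕ, (0 : ℝ) < 1 / ((n : ℝ) + 1) := fun n => by positivity
  choose h hTP hd using fun n : ℕ => tp_dense hg hp (hpos n)
  choose N C hC hh using hTP
  obtain rfl : h = fun n => tp (SI (N n)) (C n) := by ext1 n; exact funext (hh n)
  choose B hB using fun n => exists_rep (hC n)
  have hfc : ∀ n, opFourierCoeff (tp (SI (N n)) (C n)) = C n := fun n => fc_tp' _ _ (hC n)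
  have hlim : Tendsto (fun n : ℕ => 1 / ((n : ℝ) + 1)) atTop (𝓝 0) :=
    tendsto_one_div_add_atTop_nhds_zero_nat
  have hcau : CauchySeq B := by
    refine cauchySeq_of_le_tendsto_0 (fun n : ℕ => 2 * (1 / ((n : ℝ) + 1))) ?_
      (by simpa using hlim.const_mul 2)
    intro n m K hn hm
    rw [dist_eq_norm]
    have hrep : Represents (toep (C n - C m)) (B n - B m) := (hB n).sub (hB m)
    refine op_norm_le hrep (g := tp (SI (N n)) (C n) - tp (SI (N m)) (C m))
      ((tp_continuous _ _).sub (tp_continuous _ _)) ?_ ?_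
    · ext1 l
      rw [fc_sub (tp_continuous _ _) (tp_continuous _ _), hfc, hfc]; rfl
    · intro t
      have h1 := hd n t
      have h2 := hd m t
      have h3 : 1 / ((n : ℝ) + 1) ≤ 1 / ((K : ℝ) + 1) := by gcongr
      have h4 : 1 / ((m : ℝ) + 1) ≤ 1 / ((K : ℝ) + 1) := by gcongr
      have : (tp (SI (N n)) (C n) - tp (SI (N m)) (C m)) t =
        (g t - tp (SI (N m)) (C m) t) - (g t - tp (SI (N n)) (C n) t) := by
          rw [Pi.sub_apply]; abel
      rw [this]
      refine (norm_sub_le _ _).trans ?_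
      simp only at h1 h2
      linarith
  obtain ⟨A, hA⟩ := cauchySeq_tendsto_of_complete hcau
  refine ⟨A, ?_, ?_⟩
  · intro j x k
    have hCl : Tendsto (fun n => C n ((j : ℤ) - k)) atTop (𝓝 (T ((j : ℤ) - k))) := by
      rw [tendsto_iff_norm_sub_tendsto_zero]
      refine squeeze_zero (fun _ => norm_nonneg _) (fun n => ?_) hlim
      rw [norm_sub_rev, ← hT, ← hfc n, ← fc_sub hg (tp_continuous _ _)]
      exact fc_norm_le (hd n) _
    have h1 : Tendsto (fun n => C n ((j : ℤ) - k) x) atTop (𝓝 (T ((j : ℤ) - k) x)) :=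
      ((ContinuousLinearMap.apply ℂ H x).continuous.tendsto _).comp hCl
    have h2 : Tendsto (fun n => B n (lp.single 2 j x)) atTop (𝓝 (A (lp.single 2 j x))) :=
      ((ContinuousLinearMap.apply ℂ (ellTwo H) (lp.single 2 j x : ellTwo H)).continuous.tendsto _).comp hA
    have h3 : Tendsto (fun n => B n (lp.single 2 j x) k) atTop (𝓝 (A (lp.single 2 j x) k)) := by
      rw [tendsto_iff_norm_sub_tendsto_zero] at h2 ⊢
      refine squeeze_zero (fun _ => norm_nonneg _) (fun n => ?_) h2
      exact lp.norm_apply_le_norm (p := 2) (by norm_num) (B n (lp.single 2 j x) - A (lp.single 2 j x)) k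
    refine tendsto_nhds_unique h3 ?_
    simp only [hB _ j x k]
    exact h1
  · exact mem_closure_of_tendsto hA (Eventually.of_forall fun n => ⟨_, polyMat_toep (hC n), hB n⟩)

lemma fej_approx {T : ℤ → (H →L[ℂ] H)} {A : ellTwo H →L[ℂ] ellTwo H}
    (hA : Represents (toep T) A) (hc : ContinuousClass A) {ε : ℝ} (hε : 0 < ε) :
    ∃ K : ℝ, ∀ m n : ℕ, 0 < m → 0 < n → ∀ t,
      ‖fej m (opFourierCoeff (fej n T)) t - fej n T t‖ ≤ 2 * ε + K / m := by
  obtain ⟨B, ⟨b, ⟨⟨N, hN⟩, M, hM⟩, hB⟩, hd⟩ := Metric.mem_closure_iff.1 hc ε hε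
  refine ⟨(2 * N + 1) * N * M, fun m n hm hn t => ?_⟩
  set q := tp (SI n) (avg n b) with hq
  have hqc : Continuous q := tp_continuous _ _
  have hfc : Continuous (fej n T) := tp_continuous _ _
  have h1 : ∀ t, ‖(fej n T - q) t‖ ≤ ε := by
    intro t
    have h2 := tp_avg_norm hn (norm_nonneg _) (fun x y => rep_form_bound (hA.sub hB) n x y) t
    have h3 : avg n (toep T - b) = avg n (toep T) - avg n b := by
      ext1 l
      simp [avg, smul_sub]
    rw [h3, tp_sub, ← fej_eq, ← dist_eq_norm A B] at h2
    exact h2.trans hd.le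
  have h4 : opFourierCoeff q = avg n b := fc_tp' _ _ (avg_zero n b)
  have h5 : q t = tp (SI N) (avg n b) t := tp_congr _ (avg_zero n b) (avg_band n hN) t
  have h6 := fej_tp_sub hm (avg_norm n hM) (avg_band n hN) t
  rw [← h5] at h6
  have h7 := fej_norm_le hm (hfc.sub hqc) h1 t
  have h8 : opFourierCoeff (fej n T - q) = opFourierCoeff (fej n T) - avg n b := by
    ext1 l
    rw [fc_sub hfc hqc, h4, Pi.sub_apply]
  rw [h8, fej_sub] at h7
  have h9 := h1 t
  rw [Pi.sub_apply] at h9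
  have e : fej m (opFourierCoeff (fej n T)) t - fej n T t =
    (fej m (opFourierCoeff (fej n T)) t - fej m (avg n b) t) + (fej m (avg n b) t - q t)
      - (fej n T t - q t) := by abel
  rw [e]
  refine (norm_sub_le _ _).trans ?_
  have := norm_add_le (fej m (opFourierCoeff (fej n T)) t - fej m (avg n b) t)
    (fej m (avg n b) t - q t)
  linarith

lemma fej_comm (m n : ℕ) (T : ℤ → (H →L[ℂ] H)) (t : ℝ) :
    fej m (opFourierCoeff (fej n T)) t = fej n (opFourierCoeff (fej m T)) t := by
  rw [fc_fej, fc_fej]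
  unfold fej
  have h0 : ∀ n l, l ∉ SI n → wt n l = 0 := by
    intro n l hl
    simp only [SI, Finset.mem_Icc] at hl
    rw [wt, fib_eq, Nat.sub_eq_zero_of_le (by omega)]; simp
  have e : (fun l => wt n l • wt m l • T l) = fun l => wt m l • wt n l • T l := by
    ext1 l; rw [smul_comm]
  rw [e]
  apply tp_congr
  · intro l hl; rw [h0 m l hl, zero_smul]
  · intro l hl; simp [h0 n l hl]

lemma exists_symbol {T : ℤ → (H →L[ℂ] H)} {A : ellTwo H →L[ℂ] ellTwo H}
    (hA : Represents (toep T) A) (hc : ContinuousClass A) :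
    ∃ g : ℝ → (H →L[ℂ] H), Continuous g ∧ Function.Periodic g (2 * Real.pi) ∧
      ∀ l : ℤ, opFourierCoeff g l = T l := by
  have hcau : ∀ ε > 0, ∃ n₀ : ℕ, ∀ m ≥ n₀, ∀ n ≥ n₀, ∀ t, ‖fej m T t - fej n T t‖ ≤ ε := by
    intro ε hε
    obtain ⟨K, hK⟩ := fej_approx hA hc (ε := ε / 8) (by positivity)
    have hlim := (tendsto_const_div_atTop_nhds_zero_nat K).eventually
      (gt_mem_nhds (by positivity : 0 < ε / 4))
    obtain ⟨n₀, hn₀⟩ := eventually_atTop.1 (hlim.and (eventually_gt_atTop 0))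
    refine ⟨n₀, fun m hm n hn t => ?_⟩
    have h1 := hK m n (hn₀ m hm).2 (hn₀ n hn).2 t
    have h2 := hK n m (hn₀ n hn).2 (hn₀ m hm).2 t
    rw [fej_comm] at h2
    have h3 := (hn₀ m hm).1
    have h4 := (hn₀ n hn).1
    have e : fej m T t - fej n T t = (fej m (opFourierCoeff (fej n T)) t - fej n T t) -
      (fej m (opFourierCoeff (fej n T)) t - fej m T t) := by abel
    rw [e]
    refine (norm_sub_le _ _).trans ?_
    linarith
  have hpt : ∀ t, ∃ a, Tendsto (fun n => fej n T t) atTop (𝓝 a) := by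
    intro t
    apply cauchySeq_tendsto_of_complete
    rw [Metric.cauchySeq_iff]
    intro ε hε
    obtain ⟨n₀, h⟩ := hcau (ε / 2) (by positivity)
    refine ⟨n₀, fun m hm n hn => ?_⟩
    rw [dist_eq_norm]
    linarith [h m hm n hn t]
  choose g hg using hpt
  have hun : ∀ ε > 0, ∃ n₀ : ℕ, ∀ n ≥ n₀, ∀ t, ‖g t - fej n T t‖ ≤ ε := by
    intro ε hε
    obtain ⟨n₀, h⟩ := hcau ε hε
    refine ⟨n₀, fun n hn t => ?_⟩
    refine le_of_tendsto ((hg t).sub_const (fej n T t)).norm ?_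
    filter_upwards [eventually_ge_atTop n₀] with m hm using h m hm n hn t
  have hgc : Continuous g := by
    have : TendstoUniformly (fun n => fej n T) g atTop := by
      rw [Metric.tendstoUniformly_iff]
      intro ε hε
      obtain ⟨n₀, h⟩ := hun (ε / 2) (by positivity)
      filter_upwards [eventually_ge_atTop n₀] with n hn t
      rw [dist_eq_norm]
      linarith [h n hn t]
    exact this.continuous (Frequently.of_forall fun n => tp_continuous _ _)
  refine ⟨g, hgc, ?_, ?_⟩
  · intro t
    refine tendsto_nhds_unique (hg (t + 2 * Real.pi)) ?_
    have : ∀ n, fej n T (t + 2 * Real.pi) = fej n T t := fun n => tp_periodic _ _ t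
    simp only [this]
    exact hg t
  · intro l
    have h1 : Tendsto (fun n => opFourierCoeff (fej n T) l) atTop (𝓝 (opFourierCoeff g l)) := by
      rw [Metric.tendsto_nhds]
      intro ε hε
      obtain ⟨n₀, h⟩ := hun (ε / 2) (by positivity)
      filter_upwards [eventually_ge_atTop n₀] with n hn
      rw [dist_comm, dist_eq_norm, ← fc_sub hgc (show Continuous (fej n T) from tp_continuous _ _)]
      have := fc_norm_le (f := g - fej n T) (h n hn) l
      exact this.trans_lt (by linarith)
    have h2 : Tendsto (fun n => opFourierCoeff (fej n T) l) atTop (𝓝 (T l)) := by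
      simp only [fc_fej]
      simpa using (wt_tendsto l).smul_const (T l)
    exact tendsto_nhds_unique h1 h2

/-- a Toeplitz matrix `A = (T_{j−k})` lies in `𝒞(ℓ²(H))` iff there is a
continuous `g : 𝕋 → B(H)` with `ĝ(l) = T_l` for all `l`; moreover
`sup_t ‖g(t)‖ = ‖A‖_{B(ℓ²(H))}`. -/
theorem toeplitz_continuousClass_iff (T : ℤ → (H →L[ℂ] H)) :
    ((∃ A : ellTwo H →L[ℂ] ellTwo H,
        Represents (fun k j => T ((j : ℤ) - (k : ℤ))) A ∧ ContinuousClass A) ↔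
      ∃ g : ℝ → (H →L[ℂ] H), Continuous g ∧ Function.Periodic g (2 * Real.pi) ∧
        ∀ l : ℤ, opFourierCoeff g l = T l) ∧
    ∀ A : ellTwo H →L[ℂ] ellTwo H,
      Represents (fun k j => T ((j : ℤ) - (k : ℤ))) A → ContinuousClass A →
      ∀ g : ℝ → (H →L[ℂ] H), Continuous g → Function.Periodic g (2 * Real.pi) →
      (∀ l : ℤ, opFourierCoeff g l = T l) →
      (⨆ t : ℝ, ‖g t‖) = ‖A‖ := by
  refine ⟨⟨?_, ?_⟩, ?_⟩
  · rintro ⟨A, hA, hc⟩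
    exact exists_symbol hA hc
  · rintro ⟨g, hg, hp, hT⟩
    exact exists_op hg hp hT
  · intro A hA hc g hg hp hT
    have hle : ∀ t, ‖g t‖ ≤ ‖A‖ := by
      intro t
      refine le_of_tendsto (fejer_tendsto hg hp t).norm ?_
      filter_upwards [eventually_gt_atTop 0] with n hn
      rw [funext hT]
      exact fej_rep_le hn hA t
    refine le_antisymm (ciSup_le hle) ?_
    have hbdd : BddAbove (Set.range fun t => ‖g t‖) := ⟨‖A‖, by rintro _ ⟨t, rfl⟩; exact hle t⟩
    exact op_norm_le hA hg (funext hT) fun t => le_ciSup hbdd t
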